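/- Let k be a positive integer, t ∈ ℝ^k, and for each v ∈ ℝ let ψ_v ∈ ℂ^k be defined by (ψ_v)_r = exp(i v t_r). Suppose u = ψ_z + h for some z ∈ ℝ and h ∈ ℂ^k, let Ω ⊆ ℝ with z ∈ Ω, and let v̂ ∈ Ω satisfy Re⟨u, ψ_{v̂}⟩ ≥ Re⟨u, ψ_v⟩ for all v ∈ Ω. Then Re⟨ψ_z, ψ_{v̂}⟩ ≥ k − 2√k · ‖h‖₂. -/

import Mathlib

open Finset

/-- Cauchy–Schwarz against a vector with unimodular entries. -/
theorem abs_re_sum_mul_conj_le {ι : Type*} [Fintype ι] (h f : ι → ℂ) (hf : ∀ r, ‖f r‖ = 1) :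
    |(∑ r, h r * (starRingEnd ℂ) (f r)).re|
      ≤ Real.sqrt (Fintype.card ι) * Real.sqrt (∑ r, ‖h r‖ ^ 2) := by
  calc |(∑ r, h r * (starRingEnd ℂ) (f r)).re|
      ≤ ‖∑ r, h r * (starRingEnd ℂ) (f r)‖ := Complex.abs_re_le_norm _
    _ ≤ ∑ r, ‖h r * (starRingEnd ℂ) (f r)‖ := norm_sum_le _ _
    _ = ∑ r, ‖h r‖ := by simp [hf]
    _ ≤ Real.sqrt (Fintype.card ι * ∑ r, ‖h r‖ ^ 2) :=
        Real.le_sqrt_of_sq_le (sq_sum_le_card_mul_sum_sq (s := Finset.univ))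
    _ = Real.sqrt (Fintype.card ι) * Real.sqrt (∑ r, ‖h r‖ ^ 2) :=
        Real.sqrt_mul (Nat.cast_nonneg _) _

/-- Robustness of the matched-filter maximizer under additive noise: if
`u = ψ_z + h`, `z ∈ Ω`, and `v̂ ∈ Ω` maximizes `Re⟨u, ψ_v⟩` over `Ω`, then
`Re⟨ψ_z, ψ_v̂⟩ ≥ k − 2√k‖h‖₂`. -/
theorem stmt_7 (k : ℕ) (hk : 0 < k) (t : Fin k → ℝ)
    (ψ : ℝ → Fin k → ℂ)
    (hψ : ∀ (v : ℝ) (r : Fin k), ψ v r = Complex.exp (Complex.I * v * t r))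
    (z : ℝ) (h : Fin k → ℂ) (u : Fin k → ℂ)
    (hu : ∀ r, u r = ψ z r + h r)
    (Ω : Set ℝ) (hz : z ∈ Ω) (vhat : ℝ) (hvhat : vhat ∈ Ω)
    (hmax : ∀ v ∈ Ω,
      (∑ r, u r * (starRingEnd ℂ) (ψ v r)).re
        ≤ (∑ r, u r * (starRingEnd ℂ) (ψ vhat r)).re) :
    (k : ℝ) - 2 * Real.sqrt k * Real.sqrt (∑ r, ‖h r‖ ^ 2)
      ≤ (∑ r, ψ z r * (starRingEnd ℂ) (ψ vhat r)).re := by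
  have hnorm (v : ℝ) (r : Fin k) : ‖ψ v r‖ = 1 := by
    rw [hψ, mul_assoc, ← Complex.ofReal_mul, Complex.norm_exp_I_mul_ofReal]
  have hself : (∑ r, ψ z r * (starRingEnd ℂ) (ψ z r)).re = k := by
    simp [Complex.mul_conj, Complex.normSq_eq_norm_sq, hnorm]
  have hmaxz := hmax z hz
  simp only [hu, add_mul, sum_add_distrib, Complex.add_re, hself] at hmaxz
  have hbound (v : ℝ) := abs_le.mp (abs_re_sum_mul_conj_le h (ψ v) (hnorm v))
  simp only [Fintype.card_fin] at hbound
  linarith [(hbound z).1, (hbound vhat).2]
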